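/- arXiv:1105.0140 — 2 statements merged into one kernel-verified Lean document; each statement's English description precedes it below -/
import Mathlib

section
/- Let a countable sofic group G act continuously on a compact metrizable space X, and let Σ be a sofic approximation sequence for G. Then mdim_Σ(X) ≤ mdim_{Σ,M}(X). -/
open Filter Topology TopologicalSpace
open scoped ENat
open scoped Classical Pointwise

namespace SoficMD

/-- A sofic approximation sequence for a group `G`. -/
structure SoficApprox (G : Type*) [Group G] where
  d : ℕ → ℕ
  σ : ∀ i, G → Equiv.Perm (Fin (d i))
  approx_mul : ∀ s t : G, Tendsto
    (fun i => ((Finset.univ.filter fun a : Fin (d i) => σ i s (σ i t a) = σ i (s * t) a).card : ℝ) / (d i : ℝ))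
    atTop (𝓝 1)
  approx_sep : ∀ s t : G, s ≠ t → Tendsto
    (fun i => ((Finset.univ.filter fun a : Fin (d i) => σ i s a = σ i t a).card : ℝ) / (d i : ℝ))
    atTop (𝓝 0)
  d_tendsto : Tendsto d atTop atTop

/-- A continuous pseudometric on a topological space. -/
structure ContPseudoMetric (X : Type*) [TopologicalSpace X] where
  d : X → X → ℝ
  continuous' : Continuous fun p : X × X => d p.1 p.2
  nonneg : ∀ x y, 0 ≤ d x y
  symm : ∀ x y, d x y = d y x
  refl : ∀ x, d x x = 0
  triangle : ∀ x y z, d x z ≤ d x y + d y z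

/-- A continuous pseudometric on a compact Hausdorff space is a compatible metric iff it
separates points. -/
def ContPseudoMetric.IsCompatMetric {X : Type*} [TopologicalSpace X]
    (ρ : ContPseudoMetric X) : Prop :=
  ∀ x y : X, ρ.d x y = 0 → x = y

/-- A continuous pseudometric is dynamically generating if translates separate points. -/
def DynGenerating (G : Type*) {X : Type*} [Group G] [TopologicalSpace X] [MulAction G X]
    (ρ : ContPseudoMetric X) : Prop :=
  ∀ x y : X, x ≠ y → ∃ s : G, 0 < ρ.d (s • x) (s • y)

/-- Equivariance of a map between two `G`-spaces. -/
def Equivariant (G : Type*) {A B : Type*} [SMul G A] [SMul G B] (f : A → B) : Prop :=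
  ∀ (s : G) (a : A), f (s • a) = s • f a

/-- The normalized ℓ² pseudometric on maps `[d] → X`. -/
noncomputable def rho2 {X : Type*} [TopologicalSpace X] (ρ : ContPseudoMetric X) {d : ℕ}
    (φ ψ : Fin d → X) : ℝ :=
  Real.sqrt ((1 / (d : ℝ)) * ∑ a, (ρ.d (φ a) (ψ a)) ^ 2)

/-- The ℓ^∞ pseudometric on maps `[d] → X`. -/
noncomputable def rhoInfty {X : Type*} [TopologicalSpace X] (ρ : ContPseudoMetric X) {d : ℕ}
    (φ ψ : Fin d → X) : ℝ :=
  ⨆ a : Fin d, ρ.d (φ a) (ψ a)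

/-- The space of `(ρ, F, δ)`-approximately equivariant maps `[d] → X` relative to `σ`. -/
def MapSpace {G X : Type*} [Group G] [TopologicalSpace X] [MulAction G X]
    (ρ : ContPseudoMetric X) (F : Finset G) (δ : ℝ) {d : ℕ}
    (σ : G → Equiv.Perm (Fin d)) : Set (Fin d → X) :=
  {φ | ∀ s ∈ F, rho2 ρ (fun a => φ (σ s a)) (fun a => s • φ a) ≤ δ}

/-- A finite open cover. -/
def IsFinOpenCover {Y : Type*} [TopologicalSpace Y] (𝒰 : Finset (Set Y)) : Prop :=
  (∀ U ∈ 𝒰, IsOpen U) ∧ (⋃ U ∈ 𝒰, U) = Set.univ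

/-- `𝒱` refines `𝒰`. -/
def Refines {Y : Type*} (𝒱 𝒰 : Finset (Set Y)) : Prop :=
  ∀ V ∈ 𝒱, ∃ U ∈ 𝒰, V ⊆ U

/-- `ord` of a finite family of sets: the maximal multiplicity minus one. -/
noncomputable def coverOrd {Y : Type*} (𝒰 : Finset (Set Y)) : EReal :=
  (⨆ y : Y, (((𝒰.filter fun U => y ∈ U).card : ℝ) : EReal)) - 1

/-- `D(𝒰)`: the infimum of `ord 𝒱` over finite open covers `𝒱` refining `𝒰`. -/
noncomputable def coverD {Y : Type*} [TopologicalSpace Y] (𝒰 : Finset (Set Y)) : EReal :=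
  ⨅ 𝒱 ∈ {𝒱 : Finset (Set Y) | IsFinOpenCover 𝒱 ∧ Refines 𝒱 𝒰}, coverOrd 𝒱

/-- the product cover `𝒰^d` of `Y^[d]`. -/
noncomputable def prodCover {Y : Type*} (𝒰 : Finset (Set Y)) (d : ℕ) :
    Finset (Set (Fin d → Y)) :=
  (Fintype.piFinset fun _ : Fin d => 𝒰).image fun U => {φ | ∀ a, φ a ∈ U a}

/-- restriction of a cover to a subset, viewed as a cover of the subtype. -/
noncomputable def restrictCover {Y : Type*} (𝒰 : Finset (Set Y)) (Z : Set Y) :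
    Finset (Set Z) :=
  𝒰.image fun U => (Subtype.val ⁻¹' U : Set Z)

/-- `D(𝒰, ρ, F, δ, σ)`. -/
noncomputable def coverDMap {G X : Type*} [Group G] [TopologicalSpace X] [MulAction G X]
    (𝒰 : Finset (Set X)) (ρ : ContPseudoMetric X) (F : Finset G) (δ : ℝ) {d : ℕ}
    (σ : G → Equiv.Perm (Fin d)) : EReal :=
  coverD (restrictCover (prodCover 𝒰 d) (MapSpace ρ F δ σ))

/-- `D_Σ(𝒰, ρ, F, δ)`. -/
noncomputable def DSigmaFdel {G X : Type*} [Group G] [TopologicalSpace X] [MulAction G X]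
    (Sap : SoficApprox G) (𝒰 : Finset (Set X)) (ρ : ContPseudoMetric X)
    (F : Finset G) (δ : ℝ) : EReal :=
  limsup (fun i => coverDMap 𝒰 ρ F δ (Sap.σ i) * ((Sap.d i : ℝ)⁻¹ : EReal)) atTop

/-- `D_Σ(𝒰, ρ, F)`. -/
noncomputable def DSigmaF {G X : Type*} [Group G] [TopologicalSpace X] [MulAction G X]
    (Sap : SoficApprox G) (𝒰 : Finset (Set X)) (ρ : ContPseudoMetric X)
    (F : Finset G) : EReal :=
  ⨅ δ : {δ : ℝ // 0 < δ}, DSigmaFdel Sap 𝒰 ρ F δ.1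

/-- `D_Σ(𝒰, ρ)`. -/
noncomputable def DSigmaU {G X : Type*} [Group G] [TopologicalSpace X] [MulAction G X]
    (Sap : SoficApprox G) (𝒰 : Finset (Set X)) (ρ : ContPseudoMetric X) : EReal :=
  ⨅ F : {F : Finset G // F.Nonempty}, DSigmaF Sap 𝒰 ρ F.1

/-- the sofic mean topological dimension `mdim_Σ(X, ρ)`. -/
noncomputable def mdimSigma {G X : Type*} [Group G] [TopologicalSpace X] [MulAction G X]
    (Sap : SoficApprox G) (ρ : ContPseudoMetric X) : EReal :=
  ⨆ 𝒰 ∈ {𝒰 : Finset (Set X) | IsFinOpenCover 𝒰}, DSigmaU Sap 𝒰 ρ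

/-- `N_ε(Y, ρ)`: the maximal cardinality of `ε`-separated subsets. -/
noncomputable def sepNum {Y : Type*} (ρ : Y → Y → ℝ) (ε : ℝ) : ℕ∞ :=
  ⨆ E ∈ {E : Set Y | ∀ x ∈ E, ∀ y ∈ E, x ≠ y → ε ≤ ρ x y}, E.encard

/-- The extended-real logarithm of an extended natural number. -/
noncomputable def elog (n : ℕ∞) : EReal :=
  if n = ⊤ then ⊤ else if n = 0 then ⊥ else ((Real.log n.toNat : ℝ) : EReal)

/-- `log N_ε(Map(ρ,F,δ,σ), ρ_∞)`. -/
noncomputable def hCnt {G X : Type*} [Group G] [TopologicalSpace X] [MulAction G X]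
    (ρ : ContPseudoMetric X) (F : Finset G) (δ : ℝ) {d : ℕ}
    (σ : G → Equiv.Perm (Fin d)) (ε : ℝ) : EReal :=
  elog (sepNum (fun φ ψ : MapSpace ρ F δ σ => rhoInfty ρ φ.1 ψ.1) ε)

/-- `h^ε_{Σ,∞}(ρ, F, δ)`. -/
noncomputable def hEpsFdel {G X : Type*} [Group G] [TopologicalSpace X] [MulAction G X]
    (Sap : SoficApprox G) (ρ : ContPseudoMetric X) (ε : ℝ) (F : Finset G) (δ : ℝ) : EReal :=
  limsup (fun i => hCnt ρ F δ (Sap.σ i) ε * ((Sap.d i : ℝ)⁻¹ : EReal)) atTop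

/-- `h^ε_{Σ,∞}(ρ)`. -/
noncomputable def hEps {G X : Type*} [Group G] [TopologicalSpace X] [MulAction G X]
    (Sap : SoficApprox G) (ρ : ContPseudoMetric X) (ε : ℝ) : EReal :=
  ⨅ F : {F : Finset G // F.Nonempty}, ⨅ δ : {δ : ℝ // 0 < δ}, hEpsFdel Sap ρ ε F.1 δ.1

/-- The sofic mean metric dimension `mdim_{Σ,M}(X, ρ)`. -/
noncomputable def mdimSigmaM {G X : Type*} [Group G] [TopologicalSpace X] [MulAction G X]
    (Sap : SoficApprox G) (ρ : ContPseudoMetric X) : EReal :=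
  liminf (fun ε : ℝ => hEps Sap ρ ε * ((|Real.log ε|⁻¹ : ℝ) : EReal)) (𝓝[>] (0 : ℝ))

/-- The sofic mean metric dimension `mdim_{Σ,M}(X)`. -/
noncomputable def mdimSigmaMFull {G : Type*} [Group G] (Sap : SoficApprox G)
    (X : Type*) [TopologicalSpace X] [MulAction G X] : EReal :=
  ⨅ ρ : {ρ : ContPseudoMetric X // ρ.IsCompatMetric}, mdimSigmaM Sap ρ.1

/-- Følner-type characterization of amenability of a discrete group. -/
def AmenableF (G : Type*) [Group G] : Prop :=
  ∀ (K : Finset G) (ε : ℝ), 0 < ε →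
    ∃ F : Finset G, F.Nonempty ∧ (((K * F) \ F).card : ℝ) < ε * F.card

/-- The set of `(K, ε)`-invariant nonempty finite subsets of `G`. -/
noncomputable def FolnerSets {G : Type*} [Group G] (K : Finset G) (ε : ℝ) :
    Set (Finset G) :=
  {F | F.Nonempty ∧ (((K * F) \ F).card : ℝ) < ε * F.card}

/-- The cover `𝒰^F = ⋁_{s ∈ F} s⁻¹ 𝒰`. -/
noncomputable def coverJoin {G X : Type*} [Group G] [TopologicalSpace X] [MulAction G X]
    (𝒰 : Finset (Set X)) (F : Finset G) : Finset (Set X) :=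
  (F.pi fun _ => 𝒰).image fun f => ⋂ s, ⋂ (h : s ∈ F), (fun x : X => s • x) ⁻¹' f s h

/-- `mdim(𝒰)` as an inf-sup over more and more invariant sets. -/
noncomputable def mdimCoverIS {G X : Type*} [Group G] [TopologicalSpace X] [MulAction G X]
    (𝒰 : Finset (Set X)) : EReal :=
  ⨅ K : Finset G, ⨅ ε : {ε : ℝ // 0 < ε},
    ⨆ F ∈ FolnerSets K ε.1, coverD (coverJoin 𝒰 F) * ((F.card : ℝ)⁻¹ : EReal)

/-- `mdim(𝒰)` as a sup-inf over more and more invariant sets. -/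
noncomputable def mdimCoverSI {G X : Type*} [Group G] [TopologicalSpace X] [MulAction G X]
    (𝒰 : Finset (Set X)) : EReal :=
  ⨆ K : Finset G, ⨆ ε : {ε : ℝ // 0 < ε},
    ⨅ F ∈ FolnerSets K ε.1, coverD (coverJoin 𝒰 F) * ((F.card : ℝ)⁻¹ : EReal)

/-- mean topological dimension, inf-sup form. -/
noncomputable def mdimIS (G X : Type*) [Group G] [TopologicalSpace X] [MulAction G X] :
    EReal :=
  ⨆ 𝒰 ∈ {𝒰 : Finset (Set X) | IsFinOpenCover 𝒰}, mdimCoverIS (G := G) 𝒰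

/-- mean topological dimension, sup-inf form. -/
noncomputable def mdimSI (G X : Type*) [Group G] [TopologicalSpace X] [MulAction G X] :
    EReal :=
  ⨆ 𝒰 ∈ {𝒰 : Finset (Set X) | IsFinOpenCover 𝒰}, mdimCoverSI (G := G) 𝒰

/-- the pseudometric `ρ_F(x,y) = max_{s ∈ F} ρ(sx, sy)`. -/
noncomputable def rhoF {G X : Type*} [Group G] [TopologicalSpace X] [MulAction G X]
    (ρ : ContPseudoMetric X) (F : Finset G) (x y : X) : ℝ :=
  ⨆ s : F, ρ.d ((s : G) • x) ((s : G) • y)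

/-- diameter of a set w.r.t. a pseudometric given as a function. -/
noncomputable def diamP {Y : Type*} (ρ : Y → Y → ℝ) (U : Set Y) : ℝ :=
  ⨆ x : U, ⨆ y : U, ρ x y

/-- mesh of a finite cover w.r.t. a pseudometric given as a function. -/
noncomputable def meshP {Y : Type*} (ρ : Y → Y → ℝ) (𝒰 : Finset (Set Y)) : ℝ :=
  ⨆ U : 𝒰, diamP ρ U.1

/-- minimal cardinality of a finite open cover of mesh `< ε`. -/
noncomputable def minCoverCard {Y : Type*} [TopologicalSpace Y] (ρ : Y → Y → ℝ) (ε : ℝ) : ℕ :=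
  sInf {n : ℕ | ∃ 𝒰 : Finset (Set Y), IsFinOpenCover 𝒰 ∧ meshP ρ 𝒰 < ε ∧ 𝒰.card = n}

/-- `S(X, ε, ρ)` in inf-sup form. -/
noncomputable def SamenIS {G X : Type*} [Group G] [TopologicalSpace X] [MulAction G X]
    (ρ : ContPseudoMetric X) (ε : ℝ) : EReal :=
  ⨅ K : Finset G, ⨅ δ : {δ : ℝ // 0 < δ},
    ⨆ F ∈ FolnerSets K δ.1,
      ((Real.log (minCoverCard (rhoF ρ F) ε) / F.card : ℝ) : EReal)

/-- `S(X, ε, ρ)` in sup-inf form. -/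
noncomputable def SamenSI {G X : Type*} [Group G] [TopologicalSpace X] [MulAction G X]
    (ρ : ContPseudoMetric X) (ε : ℝ) : EReal :=
  ⨆ K : Finset G, ⨆ δ : {δ : ℝ // 0 < δ},
    ⨅ F ∈ FolnerSets K δ.1,
      ((Real.log (minCoverCard (rhoF ρ F) ε) / F.card : ℝ) : EReal)

/-- mean metric dimension `mdim_M(X, ρ)`, inf-sup form. -/
noncomputable def mdimMIS {G X : Type*} [Group G] [TopologicalSpace X] [MulAction G X]
    (ρ : ContPseudoMetric X) : EReal :=
  liminf (fun ε : ℝ => SamenIS (G := G) ρ ε * ((|Real.log ε|⁻¹ : ℝ) : EReal)) (𝓝[>] (0 : ℝ))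

/-- mean metric dimension `mdim_M(X, ρ)`, sup-inf form. -/
noncomputable def mdimMSI {G X : Type*} [Group G] [TopologicalSpace X] [MulAction G X]
    (ρ : ContPseudoMetric X) : EReal :=
  liminf (fun ε : ℝ => SamenSI (G := G) ρ ε * ((|Real.log ε|⁻¹ : ℝ) : EReal)) (𝓝[>] (0 : ℝ))

/-- The covering dimension of a topological space, as an extended natural number. -/
noncomputable def covDim (Y : Type*) [TopologicalSpace Y] : ℕ∞ :=
  sInf {n : ℕ∞ | ∀ 𝒰 : Finset (Set Y), IsFinOpenCover 𝒰 →
    ∃ 𝒱 : Finset (Set Y), IsFinOpenCover 𝒱 ∧ Refines 𝒱 𝒰 ∧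
      ∀ y : Y, (((𝒱.filter fun V => y ∈ V).card : ℕ∞)) ≤ n + 1}

/-- conversion of extended naturals into extended reals. -/
noncomputable def enatToEReal (n : ℕ∞) : EReal :=
  if n = ⊤ then ⊤ else ((n.toNat : ℝ) : EReal)

/-- The action of `G` on a `G`-invariant subset. -/
def invariantSubMulAction {G X : Type*} [Group G] [MulAction G X] (Y : Set X)
    (h : ∀ (s : G), ∀ x ∈ Y, s • x ∈ Y) : MulAction G Y where
  smul s y := ⟨s • (y : X), h s y y.2⟩
  one_smul y := Subtype.ext (one_smul G (y : X))
  mul_smul s t y := Subtype.ext (mul_smul s t (y : X))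

end SoficMD


open Filter Topology TopologicalSpace
open scoped ENat
open scoped Classical Pointwise

namespace SoficMD

/-- A continuous function vanishing on the diagonal is uniformly controlled by a compatible
metric. -/
theorem ContPseudoMetric.IsCompatMetric.exists_forall_lt {X : Type*} [TopologicalSpace X]
    [CompactSpace X] {ρ : ContPseudoMetric X} (hρ : ρ.IsCompatMetric) {g : X → X → ℝ}
    (hg : Continuous fun p : X × X => g p.1 p.2) (hg0 : ∀ x, g x x = 0) {θ : ℝ} (hθ : 0 < θ) :
    ∃ η > 0, ∀ x y, ρ.d x y < η → g x y < θ := by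
  have hK : IsCompact {p : X × X | θ ≤ g p.1 p.2} :=
    (isClosed_le continuous_const hg).isCompact
  rcases Set.eq_empty_or_nonempty {p : X × X | θ ≤ g p.1 p.2} with he | hne
  · refine ⟨1, one_pos, fun x y _ => ?_⟩
    by_contra! h
    exact (he.subset (show (x, y) ∈ {p : X × X | θ ≤ g p.1 p.2} from h)).elim
  · obtain ⟨p, hp, hmin⟩ := hK.exists_isMinOn hne ρ.continuous'.continuousOn
    refine ⟨ρ.d p.1 p.2, lt_of_le_of_ne (ρ.nonneg _ _) fun h => ?_, fun x y hxy => ?_⟩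
    · have hp' : θ ≤ g p.1 p.2 := hp
      rw [hρ _ _ h.symm, hg0] at hp'
      linarith
    · by_contra! h
      have : ρ.d p.1 p.2 ≤ ρ.d x y := hmin (show (x, y) ∈ {p : X × X | θ ≤ g p.1 p.2} from h)
      linarith

theorem ContPseudoMetric.IsCompatMetric.exists_sq_le {X : Type*} [TopologicalSpace X]
    [CompactSpace X] {ρ : ContPseudoMetric X} (hρ : ρ.IsCompatMetric) (ρ' : ContPseudoMetric X)
    {θ : ℝ} (hθ : 0 < θ) :
    ∃ A ≥ 1, ∀ x y, ρ'.d x y ^ 2 ≤ θ + A * ρ.d x y ^ 2 := by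
  have hcont : Continuous fun p : X × X => ρ'.d p.1 p.2 ^ 2 := ρ'.continuous'.pow 2
  obtain ⟨η, hη, h⟩ := hρ.exists_forall_lt (g := fun x y => ρ'.d x y ^ 2) hcont
    (fun x => by simp [ρ'.refl]) hθ
  obtain ⟨B, hB⟩ := (isCompact_range hcont).bddAbove
  have hB' : ∀ x y, ρ'.d x y ^ 2 ≤ |B| := fun x y =>
    (hB ⟨(x, y), rfl⟩).trans (le_abs_self B)
  refine ⟨|B| / η ^ 2 + 1, by linarith [show 0 ≤ |B| / η ^ 2 by positivity], fun x y => ?_⟩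
  rcases lt_or_ge (ρ.d x y) η with hlt | hge
  · have h1 : ρ'.d x y ^ 2 < θ := h x y hlt
    have : 0 ≤ (|B| / η ^ 2 + 1) * ρ.d x y ^ 2 := by positivity
    linarith
  · have h1 : η ^ 2 ≤ ρ.d x y ^ 2 := by gcongr
    have h2 : |B| = |B| / η ^ 2 * η ^ 2 := by field_simp
    have h3 : |B| / η ^ 2 * η ^ 2 ≤ |B| / η ^ 2 * ρ.d x y ^ 2 := by gcongr
    nlinarith [hB' x y, sq_nonneg (ρ.d x y)]

theorem ContPseudoMetric.IsCompatMetric.exists_mapSpace_subset {G X : Type*} [Group G]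
    [TopologicalSpace X] [CompactSpace X] [MulAction G X] {ρ : ContPseudoMetric X}
    (hρ : ρ.IsCompatMetric) (ρ' : ContPseudoMetric X) (F : Finset G) {δ' : ℝ} (hδ' : 0 < δ') :
    ∃ δ > 0, ∀ {d : ℕ} (σ : G → Equiv.Perm (Fin d)),
      MapSpace ρ F δ σ ⊆ MapSpace ρ' F δ' σ := by
  obtain ⟨A, hA, h⟩ := hρ.exists_sq_le ρ' (θ := δ' ^ 2 / 2) (by positivity)
  refine ⟨δ' / (2 * A), by positivity, fun {d} σ φ hφ s hs => ?_⟩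
  have h1 := (Real.sqrt_le_iff.1 (hφ s hs)).2
  refine Real.sqrt_le_iff.2 ⟨hδ'.le, ?_⟩
  have hd : (1 / (d : ℝ)) * d ≤ 1 := by
    rcases eq_or_ne (d : ℝ) 0 with h0 | h0
    · simp [h0]
    · field_simp
      exact le_rfl
  have hAsq : A * (δ' / (2 * A)) ^ 2 ≤ δ' ^ 2 / 4 := by
    rw [show A * (δ' / (2 * A)) ^ 2 = δ' ^ 2 / 4 / A by field_simp; ring]
    exact div_le_self (by positivity) hA
  calc (1 / (d : ℝ)) * ∑ a, ρ'.d (φ (σ s a)) (s • φ a) ^ 2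
      ≤ (1 / (d : ℝ)) * ∑ a, (δ' ^ 2 / 2 + A * ρ.d (φ (σ s a)) (s • φ a) ^ 2) := by
        gcongr
        exact h _ _
    _ = (1 / (d : ℝ)) * d * (δ' ^ 2 / 2)
        + A * ((1 / (d : ℝ)) * ∑ a, ρ.d (φ (σ s a)) (s • φ a) ^ 2) := by
        rw [Finset.sum_add_distrib, ← Finset.mul_sum]
        simp
        ring
    _ ≤ 1 * (δ' ^ 2 / 2) + A * (δ' / (2 * A)) ^ 2 := by gcongr
    _ ≤ δ' ^ 2 := by nlinarith [sq_nonneg δ']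

/-- A family of `1`-Lipschitz functions subordinate to an open cover, one of which is bounded
below by `r` at every point. -/
theorem ContPseudoMetric.IsCompatMetric.exists_lipschitz_subordinate {X : Type*}
    [TopologicalSpace X] [CompactSpace X] [MetrizableSpace X] {ρ : ContPseudoMetric X}
    (hρ : ρ.IsCompatMetric) {𝒰 : Finset (Set X)} (h𝒰 : IsFinOpenCover 𝒰) :
    ∃ (f : 𝒰 → X → ℝ) (r : ℝ), 0 < r ∧ (∀ U, Continuous (f U)) ∧
      (∀ U x y, |f U x - f U y| ≤ ρ.d x y) ∧ (∀ U x, 0 < f U x → x ∈ U.1) ∧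
      ∀ x, ∃ U, r ≤ f U x := by
  let _ := metrizableSpaceMetric X
  obtain ⟨δ, hδ, hball⟩ := lebesgue_number_lemma_of_metric (c := fun U : 𝒰 => U.1)
    (isCompact_univ (X := X)) (fun U => h𝒰.1 _ U.2) (by
      rw [← h𝒰.2, Set.iUnion_subtype])
  obtain ⟨η, hη, hlt⟩ := hρ.exists_forall_lt (g := fun x y : X => dist x y)
    continuous_dist (fun x => dist_self x) hδ
  let k : 𝒰 → X → X → ℝ := fun U x y => ρ.d x y + U.1.indicator (fun _ => 1) y
  have hk0 : ∀ U x y, 0 ≤ k U x y := fun U x y =>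
    add_nonneg (ρ.nonneg _ _) (Set.indicator_nonneg (fun _ _ => zero_le_one) _)
  have hbdd : ∀ U x, BddBelow (Set.range (k U x)) := fun U x =>
    ⟨0, by rintro _ ⟨y, rfl⟩; exact hk0 U x y⟩
  let f : 𝒰 → X → ℝ := fun U x => ⨅ y, k U x y
  have hle : ∀ U x y, f U x ≤ f U y + ρ.d x y := fun U x y => by
    have : Nonempty X := ⟨x⟩
    rw [← sub_le_iff_le_add]
    refine le_ciInf fun z => ?_
    have h1 : f U x ≤ k U x z := ciInf_le (hbdd U x) z
    have h2 := ρ.triangle x y z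
    simp only [k] at h1 ⊢
    linarith
  have hlip : ∀ U x y, |f U x - f U y| ≤ ρ.d x y := fun U x y => by
    have h1 := hle U x y
    have h2 := hle U y x
    rw [ρ.symm] at h2
    exact abs_le.2 ⟨by linarith, by linarith⟩
  refine ⟨f, min η 1, lt_min hη one_pos, fun U => ?_, hlip, fun U x hx => ?_, fun x => ?_⟩
  · refine continuous_iff_continuousAt.2 fun x => ?_
    have hc : Tendsto (fun y => ρ.d y x) (𝓝 x) (𝓝 0) := by
      have : Continuous fun y => ρ.d y x :=
        ρ.continuous'.comp (continuous_id.prodMk continuous_const)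
      simpa [ρ.refl] using this.tendsto x
    refine tendsto_iff_dist_tendsto_zero.2 (squeeze_zero (fun _ => dist_nonneg) (fun y => ?_) hc)
    exact hlip U y x
  · by_contra hxU
    have : f U x ≤ k U x x := ciInf_le (hbdd U x) x
    simp [k, ρ.refl, Set.indicator_of_notMem hxU] at this
    linarith
  · obtain ⟨U, hU⟩ := hball x trivial
    have : Nonempty X := ⟨x⟩
    refine ⟨U, le_ciInf fun y => ?_⟩
    by_cases hy : y ∈ U.1
    · have := ρ.nonneg x y
      simp only [k, Set.indicator_of_mem hy]
      linarith [min_le_right η 1]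
    · have h1 : η ≤ ρ.d x y := by
        by_contra! h
        exact hy (hU (by rw [Metric.mem_ball, dist_comm]; exact hlt x y h))
      simp only [k, Set.indicator_of_notMem hy]
      linarith [min_le_left η 1]

/-- The set of points lying near the face of the cubical complex with vertex `ξ` described by the
sign pattern `τ`: coordinates where `τ` is nonzero lie on the prescribed side of `ξ`, and the
remaining coordinates are positive and closer to `ξ` than the former. -/
def faceNhd {Z J : Type*} (g : J → Z → ℝ) (ξ : J → ℝ) (τ : J → SignType) : Set Z :=
  {z | (∀ j, τ j = 0 → 0 < g j z) ∧ (∀ j, τ j = 1 → ξ j < g j z) ∧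
    (∀ j, τ j = -1 → g j z < ξ j) ∧
    ∀ j k, τ j = 0 → τ k ≠ 0 → |g j z - ξ j| < |g k z - ξ k|}

theorem isOpen_faceNhd {Z J : Type*} [TopologicalSpace Z] [Finite J] {g : J → Z → ℝ}
    (hg : ∀ j, Continuous (g j)) (ξ : J → ℝ) (τ : J → SignType) :
    IsOpen (faceNhd g ξ τ) := by
  have hopen : ∀ {p : Prop} {s : Set Z}, IsOpen s → IsOpen {z | p → z ∈ s} := fun {p s} hs => by
    by_cases hp : p <;> simp [hp, hs]
  have h : faceNhd g ξ τ = (⋂ j, {z | τ j = 0 → z ∈ {z | 0 < g j z}}) ∩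
      ((⋂ j, {z | τ j = 1 → z ∈ {z | ξ j < g j z}}) ∩
      ((⋂ j, {z | τ j = -1 → z ∈ {z | g j z < ξ j}}) ∩
      ⋂ j, ⋂ k, {z | τ j = 0 → z ∈ {z | τ k ≠ 0 → z ∈ {z | |g j z - ξ j| < |g k z - ξ k|}}})) := by
    ext z
    simp only [faceNhd, Set.mem_inter_iff, Set.mem_iInter, Set.mem_ofPred_eq]
  rw [h]
  refine (isOpen_iInter_of_finite fun j => hopen (isOpen_lt continuous_const (hg j))).inter <|
    (isOpen_iInter_of_finite fun j => hopen (isOpen_lt continuous_const (hg j))).inter <|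
    (isOpen_iInter_of_finite fun j => hopen (isOpen_lt (hg j) continuous_const)).inter <|
    isOpen_iInter_of_finite fun j => isOpen_iInter_of_finite fun k => hopen (hopen ?_)
  exact isOpen_lt ((hg j).sub continuous_const).abs ((hg k).sub continuous_const).abs

theorem faceNhd_zeros_subset {Z J : Type*} [Fintype J] {g : J → Z → ℝ} {ξ : J → ℝ}
    {τ τ' : J → SignType} {z : Z} (h : z ∈ faceNhd g ξ τ) (h' : z ∈ faceNhd g ξ τ')
    (hcard : (Finset.univ.filter fun j => τ j = 0).card ≤
      (Finset.univ.filter fun j => τ' j = 0).card) {j : J} (hj : τ j = 0) : τ' j = 0 := by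
  by_contra hj'
  have hsub : (Finset.univ.filter fun j => τ' j = 0) ⊂ Finset.univ.filter fun j => τ j = 0 := by
    refine (Finset.ssubset_iff_of_subset fun k hk => ?_).2 ⟨j, by simpa using hj, by simpa using hj'⟩
    simp only [Finset.mem_filter, Finset.mem_univ, true_and] at hk ⊢
    by_contra hk'
    exact lt_asymm (h.2.2.2 j k hj hk') (h'.2.2.2 k j hk hj')
  exact absurd (Finset.card_lt_card hsub) (not_lt.2 hcard)

theorem faceNhd_injOn {Z J : Type*} [Fintype J] (g : J → Z → ℝ) (ξ : J → ℝ) (z : Z) :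
    Set.InjOn (fun τ : J → SignType => (Finset.univ.filter fun j => τ j = 0).card)
      {τ | z ∈ faceNhd g ξ τ} := by
  intro τ h τ' h' hcard
  have hzero : ∀ j, τ j = 0 ↔ τ' j = 0 := fun j =>
    ⟨faceNhd_zeros_subset h h' hcard.le, faceNhd_zeros_subset h' h hcard.ge⟩
  funext j
  have h1 := h.2.1 j
  have h2 := h.2.2.1 j
  have h1' := h'.2.1 j
  have h2' := h'.2.2.1 j
  have h0 := hzero j
  rcases hτ : τ j with _ | _ | _ <;> rcases hτ' : τ' j with _ | _ | _ <;>
    simp_all <;> linarith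

/-- If at most `m - 1` of finitely many continuous functions can simultaneously attain prescribed
positive values, then there is a finite open cover of multiplicity at most `m`, on each member of
which every function is either positive or below its prescribed value. -/
theorem exists_cover_of_card_eq_lt {Z J : Type*} [TopologicalSpace Z] [Fintype J]
    {g : J → Z → ℝ} (hg : ∀ j, Continuous (g j)) {ξ : J → ℝ} (hξ : ∀ j, 0 < ξ j) {m : ℕ}
    (hm : ∀ z, (Finset.univ.filter fun j => g j z = ξ j).card < m) :
    ∃ 𝒱 : Finset (Set Z), IsFinOpenCover 𝒱 ∧ (∀ z, (𝒱.filter fun V => z ∈ V).card ≤ m) ∧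
      ∀ V ∈ 𝒱, ∀ j, (∀ z ∈ V, 0 < g j z) ∨ ∀ z ∈ V, g j z < ξ j := by
  let T : Finset (J → SignType) :=
    Finset.univ.filter fun τ => (Finset.univ.filter fun j => τ j = 0).card < m
  refine ⟨T.image (faceNhd g ξ), ⟨fun V hV => ?_, ?_⟩, fun z => ?_, fun V hV j => ?_⟩
  · obtain ⟨τ, -, rfl⟩ := Finset.mem_image.1 hV
    exact isOpen_faceNhd hg ξ τ
  · refine Set.eq_univ_of_forall fun z => ?_
    let τ : J → SignType := fun j => SignType.sign (g j z - ξ j)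
    have h0 : ∀ j, τ j = 0 ↔ g j z = ξ j := fun j => by simp [τ, sub_eq_zero]
    have hτ : τ ∈ T := by simpa [T, h0] using hm z
    refine Set.mem_iUnion₂.2 ⟨_, Finset.mem_image_of_mem _ hτ, fun j hj => ?_, fun j hj => ?_,
      fun j hj => ?_, fun j k hj hk => ?_⟩
    · rw [(h0 j).1 hj]
      exact hξ j
    · exact sub_pos.1 (sign_eq_one_iff.1 hj)
    · exact sub_neg.1 (sign_eq_neg_one_iff.1 hj)
    · rw [(h0 j).1 hj, sub_self, abs_zero]
      exact abs_pos.2 (sub_ne_zero.2 fun h => hk ((h0 k).2 h))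
  · have h1 : (T.image (faceNhd g ξ)).filter (fun V => z ∈ V) ⊆
        (T.filter fun τ => z ∈ faceNhd g ξ τ).image (faceNhd g ξ) := fun V hV => by
      obtain ⟨hV, hz⟩ := Finset.mem_filter.1 hV
      obtain ⟨τ, hτ, rfl⟩ := Finset.mem_image.1 hV
      exact Finset.mem_image_of_mem _ (Finset.mem_filter.2 ⟨hτ, hz⟩)
    refine (Finset.card_le_card h1).trans (Finset.card_image_le.trans ?_)
    rw [← Finset.card_range m]
    refine Finset.card_le_card_of_injOn
      (fun τ : J → SignType => (Finset.univ.filter fun j => τ j = 0).card)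
      (fun τ hτ => ?_) ((faceNhd_injOn g ξ z).mono fun τ hτ => ?_)
    · simpa [T] using (Finset.mem_filter.1 (Finset.mem_filter.1 hτ).1).2
    · exact (Finset.mem_filter.1 hτ).2
  · obtain ⟨τ, -, rfl⟩ := Finset.mem_image.1 hV
    rcases hτ : τ j with _ | _ | _
    · exact Or.inl fun z hz => hz.1 j hτ
    · exact Or.inr fun z hz => hz.2.2.1 j hτ
    · exact Or.inl fun z hz => (hξ j).trans (hz.2.1 j hτ)

/-- A grid point which agrees up to `ε` with each of finitely many given points in fewer than `m`
coordinates. -/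
theorem exists_grid_card_lt {J : Type*} [Fintype J] (E : Finset (J → ℝ)) {M m : ℕ} (hM : 0 < M)
    {ε : ℝ} (h : 2 ^ Fintype.card J * E.card < M ^ m) :
    ∃ ξ : J → Fin M, ∀ c ∈ E,
      (Finset.univ.filter fun j => |((ξ j : ℕ) + 1) * (2 * ε) - c j| < ε).card < m := by
  rcases lt_or_ge (Fintype.card J) m with hlt | hle
  · exact ⟨fun _ => ⟨0, hM⟩, fun c _ => (Finset.card_le_univ _).trans_lt hlt⟩
  let near : ℝ → Finset (Fin M) := fun x =>
    Finset.univ.filter fun r => |((r : ℕ) + 1) * (2 * ε) - x| < ε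
  have hnear : ∀ x, (near x).card ≤ 1 := fun x => by
    refine Finset.card_le_one.2 fun r hr s hs => ?_
    simp only [near, Finset.mem_filter, Finset.mem_univ, true_and, abs_lt] at hr hs
    have hε : 0 < ε := by linarith [hr.1, hr.2]
    have h1 : ((r : ℕ) : ℝ) < (s : ℕ) + 1 := by nlinarith [hr.2, hs.1]
    have h2 : ((s : ℕ) : ℝ) < (r : ℕ) + 1 := by nlinarith [hr.1, hs.2]
    have h1' : (r : ℕ) < (s : ℕ) + 1 := by exact_mod_cast h1
    have h2' : (s : ℕ) < (r : ℕ) + 1 := by exact_mod_cast h2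
    exact Fin.ext (by omega)
  let box : (J → ℝ) → Finset J → Finset (J → Fin M) := fun c S =>
    Fintype.piFinset fun j => if j ∈ S then near (c j) else Finset.univ
  have hbox : ∀ c, ∀ S ∈ Finset.univ.powersetCard m,
      (box c S).card ≤ M ^ (Fintype.card J - m) := fun c S hS => by
    rw [Finset.mem_powersetCard] at hS
    rw [Fintype.card_piFinset]
    calc ∏ j, (if j ∈ S then near (c j) else Finset.univ).card
        ≤ ∏ j, if j ∈ S then 1 else M := by
          refine Finset.prod_le_prod' fun j _ => ?_
          split_ifs
          · exact hnear _
          · simp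
      _ = M ^ (Fintype.card J - m) := by
          rw [Finset.prod_ite, Finset.prod_const_one, one_mul, Finset.prod_const]
          congr 1
          rw [← hS.2, ← Finset.card_compl]
          congr 1
          ext j
          simp
  let bad : Finset (J → Fin M) := E.biUnion fun c => (Finset.univ.powersetCard m).biUnion (box c)
  have hbad : bad.card < (Finset.univ : Finset (J → Fin M)).card := by
    calc bad.card ≤ E.card * (2 ^ Fintype.card J * M ^ (Fintype.card J - m)) := by
          refine Finset.card_biUnion_le_card_mul _ _ _ fun c _ => ?_
          refine (Finset.card_biUnion_le_card_mul _ _ _ (hbox c)).trans ?_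
          gcongr
          rw [Finset.card_powersetCard, Finset.card_univ]
          exact Nat.choose_le_two_pow _ _
      _ = (2 ^ Fintype.card J * E.card) * M ^ (Fintype.card J - m) := by ring
      _ < M ^ m * M ^ (Fintype.card J - m) := by gcongr
      _ = (Finset.univ : Finset (J → Fin M)).card := by
          rw [← pow_add, Nat.add_sub_cancel' hle]
          simp
  obtain ⟨ξ, -, hξ⟩ := Finset.exists_mem_notMem_of_card_lt_card hbad
  refine ⟨ξ, fun c hc => ?_⟩
  by_contra! hcard
  obtain ⟨S, hS, hSm⟩ := Finset.exists_subset_card_eq hcard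
  refine hξ (Finset.mem_biUnion.2 ⟨c, hc, Finset.mem_biUnion.2 ⟨S,
    Finset.mem_powersetCard.2 ⟨Finset.subset_univ _, hSm⟩, Fintype.mem_piFinset.2 fun j => ?_⟩⟩)
  split_ifs with hj
  · simpa [near] using hS hj
  · exact Finset.mem_univ _

theorem le_rhoInfty {X : Type*} [TopologicalSpace X] (ρ : ContPseudoMetric X) {d : ℕ}
    (φ ψ : Fin d → X) (a : Fin d) : ρ.d (φ a) (ψ a) ≤ rhoInfty ρ φ ψ :=
  le_ciSup (f := fun a => ρ.d (φ a) (ψ a)) (Set.finite_range _).bddAbove a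

theorem coverD_of_isEmpty {Y : Type*} [TopologicalSpace Y] [IsEmpty Y] (𝒰 : Finset (Set Y)) :
    coverD 𝒰 = ⊥ := by
  refine le_bot_iff.1 (iInf₂_le_of_le ∅ ⟨⟨by simp, by simp [Set.eq_empty_of_isEmpty]⟩,
    by simp [Refines]⟩ ?_)
  simp [coverOrd]

/-- A bound for the order of the product cover on a subset of `X^d` possessing a small net. -/
theorem coverD_restrictCover_le {X : Type*} [TopologicalSpace X] {ρ : ContPseudoMetric X}
    {𝒰 : Finset (Set X)} {f : 𝒰 → X → ℝ} {r : ℝ}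
    (hf : ∀ U, Continuous (f U)) (hlip : ∀ U x y, |f U x - f U y| ≤ ρ.d x y)
    (hpos : ∀ U x, 0 < f U x → x ∈ U.1) (hr : ∀ x, ∃ U, r ≤ f U x)
    {d : ℕ} {Z : Set (Fin d → X)} (hZ : Z.Nonempty) {E : Finset (Fin d → X)} {ε : ℝ} (hε : 0 < ε)
    (hE : ∀ z ∈ Z, ∃ c ∈ E, rhoInfty ρ z c < ε) {M m : ℕ} (hM : 0 < M) (hMr : M * (2 * ε) ≤ r)
    (hcard : 2 ^ (d * 𝒰.card) * E.card < M ^ m) :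
    coverD (restrictCover (prodCover 𝒰 d) Z) ≤ ((m : ℝ) : EReal) - 1 := by
  let J := Fin d × 𝒰
  let Φ : (Fin d → X) → J → ℝ := fun φ j => f j.2 (φ j.1)
  obtain ⟨ξ, hξ⟩ := exists_grid_card_lt (E.image Φ) (m := m) hM (ε := ε) (by
    refine lt_of_le_of_lt ?_ hcard
    rw [show Fintype.card J = d * 𝒰.card by simp [J]]
    gcongr
    exact Finset.card_image_le)
  let x : J → ℝ := fun j => ((ξ j : ℕ) + 1) * (2 * ε)
  have hxr : ∀ j, x j ≤ r := fun j => by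
    refine le_trans ?_ hMr
    have : ((ξ j : ℕ) : ℝ) + 1 ≤ M := by exact_mod_cast (ξ j).2
    simp only [x]
    gcongr
  obtain ⟨𝒱, h𝒱, hmult, hside⟩ := exists_cover_of_card_eq_lt (Z := Z) (J := J)
    (g := fun j z => f j.2 (z.1 j.1))
    (fun j => (hf j.2).comp ((continuous_apply j.1).comp continuous_subtype_val))
    (ξ := x) (fun j => by positivity) (m := m) (fun z => by
      obtain ⟨c, hc, hzc⟩ := hE z.1 z.2
      refine lt_of_le_of_lt (Finset.card_le_card fun j hj => ?_)
        (hξ _ (Finset.mem_image_of_mem Φ hc))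
      have hj' : f j.2 (z.1 j.1) = x j := by simpa using hj
      have h1 : |x j - Φ c j| < ε := by
        rw [← hj']
        exact ((hlip _ _ _).trans (le_rhoInfty ρ _ _ _)).trans_lt hzc
      simpa [x] using h1)
  refine iInf₂_le_of_le 𝒱 ⟨h𝒱, fun V hV => ?_⟩ ?_
  · have hex : ∀ a, ∃ U ∈ 𝒰, ∀ z ∈ V, z.1 a ∈ U := fun a => by
      by_cases hU : ∃ U : 𝒰, ∀ z ∈ V, 0 < f U (z.1 a)
      · obtain ⟨U, hU⟩ := hU
        exact ⟨U, U.2, fun z hz => hpos U _ (hU z hz)⟩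
      · push Not at hU
        obtain ⟨z₀, hz₀⟩ := hZ
        obtain ⟨U₀, -⟩ := hr (z₀ a)
        refine ⟨U₀, U₀.2, fun z hz => ?_⟩
        obtain ⟨U, hU'⟩ := hr (z.1 a)
        rcases hside V hV (a, U) with h | h
        · obtain ⟨w, hw, hw'⟩ := hU U
          exact absurd (h w hw) (not_lt.2 hw')
        · exact absurd ((h z hz).trans_le (hxr _)) (not_lt.2 hU')
    choose U hU𝒰 hU using hex
    refine ⟨_, Finset.mem_image_of_mem _ (Finset.mem_image_of_mem _
      (Fintype.mem_piFinset.2 hU𝒰)), fun z hz a => hU a z hz⟩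
  · refine EReal.sub_le_sub (iSup_le fun z => ?_) le_rfl
    exact_mod_cast hmult z

theorem exists_net_of_hCnt_lt {G X : Type*} [Group G] [TopologicalSpace X] [MulAction G X]
    {ρ : ContPseudoMetric X} {F : Finset G} {δ : ℝ} {d : ℕ} {σ : G → Equiv.Perm (Fin d)}
    {ε : ℝ} (hε : 0 < ε) {r : ℝ} (h : hCnt ρ F δ σ ε < r) :
    ∃ E : Finset (Fin d → X), (∀ z ∈ MapSpace ρ F δ σ, ∃ c ∈ E, rhoInfty ρ z c < ε) ∧
      (E.card : ℝ) < Real.exp r := by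
  let Y := MapSpace ρ F δ σ
  let dist' : Y → Y → ℝ := fun φ ψ => rhoInfty ρ φ.1 ψ.1
  let Sep : Set (Set Y) := {E | ∀ x ∈ E, ∀ y ∈ E, x ≠ y → ε ≤ dist' x y}
  have hN : hCnt ρ F δ σ ε = elog (sepNum dist' ε) := rfl
  have hsup : sepNum dist' ε = ⨆ E : Sep, E.1.encard := by
    rw [sepNum, iSup_subtype']
  have htop : sepNum dist' ε < ⊤ := by
    refine lt_top_iff_ne_top.2 fun ht => ?_
    rw [hN, ht] at h
    simp [elog] at h
  have : Nonempty Sep := ⟨⟨∅, by simp [Sep]⟩⟩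
  obtain ⟨⟨E, hE⟩, hEmax⟩ := ENat.exists_eq_iSup_of_lt_top (hsup ▸ htop)
  rw [← hsup] at hEmax
  have hfin : E.Finite := Set.encard_lt_top_iff.1 (hEmax ▸ htop)
  have hself : ∀ z : Y, dist' z z = 0 := fun z => by simp [dist', rhoInfty, ρ.refl]
  have hsymm : ∀ z w : Y, dist' z w = dist' w z := fun z w => by
    simp only [dist', rhoInfty, ρ.symm]
  refine ⟨(hfin.image Subtype.val).toFinset, fun z hz => ?_, ?_⟩
  · by_contra! hfar
    have hfar' : ∀ c ∈ E, ε ≤ dist' ⟨z, hz⟩ c := fun c hc =>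
      hfar c.1 (by simpa using hc)
    have hzE : (⟨z, hz⟩ : Y) ∉ E := fun hmem => by
      have := hfar' _ hmem
      rw [hself] at this
      linarith
    have hins : insert (⟨z, hz⟩ : Y) E ∈ Sep := by
      rintro x (rfl | hx) y (rfl | hy) hxy
      · exact absurd rfl hxy
      · exact hfar' y hy
      · rw [hsymm]
        exact hfar' x hx
      · exact hE x hx y hy hxy
    have hle : (insert (⟨z, hz⟩ : Y) E).encard ≤ E.encard := by
      rw [show E.encard = ⨆ E : Sep, E.1.encard from hEmax.trans hsup]
      exact le_iSup (fun E : Sep => E.1.encard) ⟨_, hins⟩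
    rw [Set.encard_insert_of_notMem hzE] at hle
    exact absurd hle (not_le.2 (ENat.lt_add_one_iff hfin.encard_lt_top.ne |>.2 le_rfl))
  · have hc : (hfin.image Subtype.val).toFinset.card = (sepNum dist' ε).toNat := by
      rw [← hEmax, ← Set.ncard_eq_toFinset_card _ (hfin.image _), Set.ncard_image_of_injective _
        Subtype.val_injective, Set.ncard]
    rw [hc]
    rcases eq_or_ne (sepNum dist' ε) 0 with h0 | h0
    · simp [h0, Real.exp_pos]
    · rw [hN, elog, if_neg htop.ne, if_neg h0, EReal.coe_lt_coe_iff] at h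
      refine (Real.log_lt_iff_lt_exp ?_).1 h
      exact_mod_cast Nat.pos_of_ne_zero fun h' => by
        rcases (ENat.toNat_eq_zero).1 h' with h' | h'
        · exact h0 h'
        · exact htop.ne h'

/-- The counting inequality behind the choice of the grid, in logarithmic form. -/
theorem two_pow_mul_lt_pow {d k n M : ℕ} (hd : 0 < d) {C τ r ε : ℝ} (hCτ : 0 < C + τ)
    (hε : 0 < ε) (hr : 0 < r) (hM : r / (4 * ε) ≤ M) (hn : 0 < n)
    (hnC : (n : ℝ) < Real.exp (C * -Real.log ε * d))
    (hsmall : k * Real.log 2 + (C + τ) * Real.log (4 / r) ≤ τ * -Real.log ε) :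
    2 ^ (d * k) * n < M ^ ⌈(C + τ) * d⌉₊ := by
  have hdR : (0 : ℝ) < d := by exact_mod_cast hd
  have hnR : (0 : ℝ) < n := by exact_mod_cast hn
  have hMR : (0 : ℝ) < M := lt_of_lt_of_le (by positivity) hM
  have hr4 : (0 : ℝ) < r / (4 * ε) := by positivity
  have hlogM : -Real.log ε - Real.log (4 / r) ≤ Real.log M := by
    refine le_trans (le_of_eq ?_) (Real.log_le_log hr4 hM)
    rw [Real.log_div hr.ne' (by positivity), Real.log_mul (by norm_num) hε.ne',
      Real.log_div (by norm_num) hr.ne']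
    ring
  have hM1 : 0 ≤ Real.log M := Real.log_natCast_nonneg M
  have hlogn : Real.log n < C * -Real.log ε * d := (Real.log_lt_iff_lt_exp hnR).2 hnC
  have hmain : Real.log ((2 : ℝ) ^ (d * k) * n) < Real.log ((M : ℝ) ^ ⌈(C + τ) * d⌉₊) := by
    rw [Real.log_mul (by positivity) hnR.ne', Real.log_pow, Real.log_pow]
    push_cast
    calc d * k * Real.log 2 + Real.log n
        < d * k * Real.log 2 + C * -Real.log ε * d := by gcongr
      _ = (k * Real.log 2 + C * -Real.log ε) * d := by ring
      _ ≤ ((C + τ) * (-Real.log ε - Real.log (4 / r))) * d := by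
          gcongr
          linarith
      _ ≤ ((C + τ) * Real.log M) * d := by gcongr
      _ = (C + τ) * d * Real.log M := by ring
      _ ≤ ⌈(C + τ) * d⌉₊ * Real.log M := by
          gcongr
          exact Nat.le_ceil _
  have := (Real.log_lt_log_iff (by positivity) (by positivity)).1 hmain
  exact_mod_cast this

theorem DSigmaU_le {G : Type*} [Group G] (Sap : SoficApprox G) {X : Type*} [TopologicalSpace X]
    [CompactSpace X] [MetrizableSpace X] [MulAction G X] {ρ ρ' : ContPseudoMetric X}
    (hρ : ρ.IsCompatMetric) (hρ' : ρ'.IsCompatMetric) {𝒰 : Finset (Set X)}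
    (h𝒰 : IsFinOpenCover 𝒰) {C τ : ℝ} (hτ : 0 < τ) (hC : mdimSigmaM Sap ρ' < C) :
    DSigmaU Sap 𝒰 ρ ≤ ((C + τ : ℝ) : EReal) := by
  obtain ⟨f, r, hr, hf, hlip, hpos, hfr⟩ := hρ'.exists_lipschitz_subordinate h𝒰
  have hlog : Tendsto (fun ε : ℝ => τ * -Real.log ε) (𝓝[>] 0) atTop :=
    (tendsto_neg_atBot_atTop.comp Real.tendsto_log_nhdsGT_zero).const_mul_atTop hτ
  have hsmall := hlog.eventually_ge_atTop
    (𝒰.card * Real.log 2 + (C + τ) * Real.log (4 / r))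
  have hlt : ∀ᶠ ε : ℝ in 𝓝[>] 0, ε < min 1 (r / 4) :=
    (eventually_lt_nhds (by positivity : (0 : ℝ) < min 1 (r / 4))).filter_mono nhdsWithin_le_nhds
  obtain ⟨ε, hεC, hεsmall, hεlt, hε⟩ := ((frequently_lt_of_liminf_lt (by isBoundedDefault)
    hC).and_eventually (hsmall.and (hlt.and self_mem_nhdsWithin))).exists
  have hε0 : 0 < ε := hε
  have hε1 : ε < 1 := hεlt.trans_le (min_le_left _ _)
  have hεr : ε < r / 4 := hεlt.trans_le (min_le_right _ _)
  have hlogε : 0 < -Real.log ε := neg_pos.2 (Real.log_neg hε0 hε1)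
  rw [abs_of_neg (neg_pos.1 hlogε), EReal.coe_inv, ← div_eq_mul_inv,
    EReal.div_lt_iff (by exact_mod_cast hlogε) (EReal.coe_ne_top _)] at hεC
  obtain ⟨⟨F, hF⟩, hεF⟩ := iInf_lt_iff.1 hεC
  obtain ⟨⟨δ', hδ'⟩, hεδ⟩ := iInf_lt_iff.1 hεF
  obtain ⟨δ, hδ, hsub⟩ := hρ.exists_mapSpace_subset ρ' F hδ'
  refine iInf_le_of_le ⟨F, hF⟩ (iInf_le_of_le ⟨δ, hδ⟩ (limsup_le_of_le (by isBoundedDefault) ?_))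
  filter_upwards [eventually_lt_of_limsup_lt hεδ, Sap.d_tendsto.eventually_gt_atTop 0]
    with i hi hd
  have hdR : (0 : ℝ) < Sap.d i := by exact_mod_cast hd
  have hdE : (0 : EReal) < ((Sap.d i : ℝ) : EReal) := by exact_mod_cast hdR
  rw [← div_eq_mul_inv, EReal.div_lt_iff hdE (EReal.coe_ne_top _)] at hi
  rw [← div_eq_mul_inv, EReal.div_le_iff_le_mul hdE (EReal.coe_ne_top _)]
  obtain ⟨E, hE, hEcard⟩ := exists_net_of_hCnt_lt (r := C * -Real.log ε * Sap.d i) hε0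
    (by exact_mod_cast hi)
  rcases (MapSpace ρ F δ (Sap.σ i)).eq_empty_or_nonempty with hZ | hZ
  · have : IsEmpty (MapSpace ρ F δ (Sap.σ i)) := Set.isEmpty_coe_sort.2 hZ
    rw [coverDMap, coverD_of_isEmpty]
    exact bot_le
  have hEpos : 0 < E.card := by
    obtain ⟨z, hz⟩ := hZ
    obtain ⟨c, hc, -⟩ := hE z (hsub _ hz)
    exact Finset.card_pos.2 ⟨c, hc⟩
  have hC0 : 0 < C := by
    have h1 : (1 : ℝ) ≤ E.card := by exact_mod_cast hEpos
    have h2 : 0 < C * -Real.log ε * Sap.d i := Real.one_lt_exp_iff.1 (h1.trans_lt hEcard)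
    exact pos_of_mul_pos_left (pos_of_mul_pos_left h2 hdR.le) hlogε.le
  have hfloor : r / (4 * ε) ≤ (⌊r / (2 * ε)⌋₊ : ℝ) := by
    have h1 : 1 ≤ r / (4 * ε) := by
      rw [le_div_iff₀ (by positivity)]
      linarith
    have h2 := Nat.lt_floor_add_one (r / (2 * ε))
    have h3 : r / (2 * ε) = 2 * (r / (4 * ε)) := by
      field_simp
      norm_num
    linarith
  have hM : 0 < ⌊r / (2 * ε)⌋₊ := by
    have : (0 : ℝ) < (⌊r / (2 * ε)⌋₊ : ℝ) := lt_of_lt_of_le (by positivity) hfloor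
    exact_mod_cast this
  have hMr : (⌊r / (2 * ε)⌋₊ : ℝ) * (2 * ε) ≤ r :=
    (le_div_iff₀ (by positivity)).1 (Nat.floor_le (by positivity))
  refine (coverD_restrictCover_le hf hlip hpos hfr hZ hε0 (fun z hz => hE z (hsub _ hz)) hM hMr
    (two_pow_mul_lt_pow hd (by positivity) hε0 hr hfloor hEpos hEcard hεsmall)).trans ?_
  have hceil := Nat.ceil_lt_add_one (show 0 ≤ (C + τ) * Sap.d i by positivity)
  have hfin : (⌈(C + τ) * Sap.d i⌉₊ : ℝ) - 1 ≤ Sap.d i * (C + τ) := by linarith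
  exact_mod_cast hfin

/-- For a continuous action of a countable sofic group on a compact metrizable
space, `mdim_Σ(X) ≤ mdim_{Σ,M}(X)`. -/
theorem mdimSigma_le_mdimSigmaM {G : Type*} [Group G] [Countable G] (Sap : SoficApprox G)
    {X : Type*} [TopologicalSpace X] [CompactSpace X] [MetrizableSpace X]
    [MulAction G X] [ContinuousConstSMul G X]
    (ρ : ContPseudoMetric X) (hρ : ρ.IsCompatMetric) :
    mdimSigma Sap ρ ≤ mdimSigmaMFull Sap X := by
  refine iSup₂_le fun 𝒰 h𝒰 => le_iInf fun ⟨ρ', hρ'⟩ =>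
    le_of_forall_gt_imp_ge_of_dense fun a ha => ?_
  obtain ⟨C, hC, hCa⟩ := EReal.lt_iff_exists_real_btwn.1 ha
  obtain ⟨C', hCC', hC'a⟩ := EReal.lt_iff_exists_real_btwn.1 hCa
  have hτ : 0 < C' - C := sub_pos.2 (EReal.coe_lt_coe_iff.1 hCC')
  refine (DSigmaU_le Sap hρ hρ' h𝒰 hτ hC).trans ?_
  rw [add_sub_cancel]
  exact hC'a.le

end SoficMD
end

section
/- Let W be a finite set, Z a closed subset of [0,1]^W, m ∈ ℕ, and ξ ∈ (0,1)^W such that for every S ⊆ W with |S| ≥ m the restriction ξ|_S does not belong to {z|_S : z ∈ Z}. Then there exists a continuous map Ψ : Z → [0,1]^W such that the covering dimension of Ψ(Z) is at most m, and for every z ∈ Z and w ∈ W: if z_w = 0 then Ψ(z)_w = 0, and if z_w = 1 then Ψ(z)_w = 1. -/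
open Filter Topology TopologicalSpace
open scoped ENat
open scoped Classical Pointwise

open Filter Topology TopologicalSpace
open scoped ENat
open scoped Classical Pointwise

namespace SoficMD

/-- The open cell of the grid in the cube with mesh `1 / N` and shift `θ`, indexed by `c`. -/
def gridCell {W : Type*} (Y : Set (W → Set.Icc (0 : ℝ) 1)) (N : ℕ) (θ : ℝ) (c : W → ℤ) :
    Set Y :=
  {y | ∀ w, (c w : ℝ) < N * (y.1 w : ℝ) - θ ∧ N * (y.1 w : ℝ) - θ < c w + 1}

theorem isOpen_gridCell {W : Type*} [Fintype W] (Y : Set (W → Set.Icc (0 : ℝ) 1)) (N : ℕ)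
    (θ : ℝ) (c : W → ℤ) : IsOpen (gridCell Y N θ c) := by
  have hcont : ∀ w, Continuous fun y : Y => N * (y.1 w : ℝ) - θ := fun w =>
    (continuous_const.mul (continuous_subtype_val.comp
      ((continuous_apply w).comp continuous_subtype_val))).sub continuous_const
  simp only [gridCell, Set.ofPred_forall, Set.ofPred_and]
  exact isOpen_iInter_of_finite fun w =>
    (isOpen_lt continuous_const (hcont w)).inter (isOpen_lt (hcont w) continuous_const)

theorem eq_floor_of_mem_gridCell {W : Type*} {Y : Set (W → Set.Icc (0 : ℝ) 1)} {N : ℕ}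
    {θ : ℝ} {c : W → ℤ} {y : Y} (hy : y ∈ gridCell Y N θ c) :
    c = fun w => ⌊N * (y.1 w : ℝ) - θ⌋ := by
  funext w
  exact (Int.floor_eq_iff.2 ⟨(hy w).1.le, (hy w).2⟩).symm

theorem dist_lt_of_mem_gridCell {W : Type*} [Fintype W] {Y : Set (W → Set.Icc (0 : ℝ) 1)}
    {N : ℕ} {θ δ : ℝ} (hδ : 0 < δ) (hN : 1 < N * δ) {c : W → ℤ} {x y : Y}
    (hx : x ∈ gridCell Y N θ c) (hy : y ∈ gridCell Y N θ c) : dist x y < δ := by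
  rw [Subtype.dist_eq, dist_pi_lt_iff hδ]
  intro w
  have hN0 : (0 : ℝ) < N := pos_of_mul_pos_left (by linarith) hδ.le
  rw [Subtype.dist_eq, Real.dist_eq, abs_sub_lt_iff]
  have hx' := hx w
  have hy' := hy w
  constructor <;> refine lt_of_mul_lt_mul_left ?_ hN0.le <;> linarith

/-- If fewer than `m + 1` coordinates of `y` are interior, then `y` avoids the walls of one of
`m + 1` grids whose walls are pairwise disjoint and contained in the interior. -/
theorem exists_mem_gridCell {W : Type*} [Fintype W] {Y : Set (W → Set.Icc (0 : ℝ) 1)} {m : ℕ}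
    (y : Y) (hy : (Finset.univ.filter fun w => (y.1 w : ℝ) ∈ Set.Ioo (0 : ℝ) 1).card ≤ m)
    (N : ℕ) : ∃ j : Fin (m + 1), y ∈ gridCell Y N (((j : ℕ) + 1 : ℝ) / (m + 2))
      fun w => ⌊N * (y.1 w : ℝ) - ((j : ℕ) + 1 : ℝ) / (m + 2)⌋ := by
  by_contra! hcon
  have hwall : ∀ j : Fin (m + 1), ∃ w, ∃ n : ℤ,
      (n : ℝ) = N * (y.1 w : ℝ) - ((j : ℕ) + 1 : ℝ) / (m + 2) := by
    intro j
    by_contra! hne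
    exact hcon j fun w => ⟨lt_of_le_of_ne (Int.floor_le _) (hne w _), Int.lt_floor_add_one _⟩
  choose f n hn using hwall
  have hm : (0 : ℝ) < m + 2 := by positivity
  have hmul : ∀ j, (m + 2) * (N * (y.1 (f j) : ℝ)) = n j * (m + 2) + (j : ℕ) + 1 := by
    intro j
    have := hn j
    field_simp at this
    linarith
  have hinj : Function.Injective f := by
    intro i j hij
    have hi := hmul i
    rw [hij, hmul j] at hi
    have hZ : n j * ((m : ℤ) + 2) + (j : ℕ) = n i * ((m : ℤ) + 2) + (i : ℕ) := by
      have : (n j : ℝ) * (m + 2) + (j : ℕ) = n i * (m + 2) + (i : ℕ) := by linarith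
      exact_mod_cast this
    have hmod := congrArg (· % ((m : ℤ) + 2)) hZ
    simp only [Int.mul_add_emod_self_right] at hmod
    rw [Int.emod_eq_of_lt (by omega) (by omega), Int.emod_eq_of_lt (by omega) (by omega)] at hmod
    exact Fin.ext (by omega)
  have hinterior : ∀ j, (y.1 (f j) : ℝ) ∈ Set.Ioo (0 : ℝ) 1 := by
    intro j
    have hwall_ne : ∀ k : ℤ, ((m : ℝ) + 2) * k ≠ n j * (m + 2) + (j : ℕ) + 1 := by
      intro k hk
      have hZ : ((m : ℤ) + 2) * k = n j * ((m : ℤ) + 2) + ((j : ℕ) + 1 : ℤ) := by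
        have : ((m : ℝ) + 2) * k = n j * (m + 2) + ((j : ℕ) + 1) := by linarith
        exact_mod_cast this
      have hmod := congrArg (· % ((m : ℤ) + 2)) hZ
      simp only [Int.mul_add_emod_self_right, Int.mul_emod_right] at hmod
      rw [Int.emod_eq_of_lt (by omega) (by omega)] at hmod
      omega
    refine ⟨lt_of_le_of_ne (y.1 (f j)).2.1 fun h => ?_, lt_of_le_of_ne (y.1 (f j)).2.2 fun h => ?_⟩
    · refine hwall_ne 0 ?_
      rw [← hmul j, ← h]
      simp
    · refine hwall_ne N ?_
      rw [← hmul j, h]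
      simp
  have hle := Finset.card_le_card_of_injOn (s := Finset.univ)
    (t := Finset.univ.filter fun w => (y.1 w : ℝ) ∈ Set.Ioo (0 : ℝ) 1) f
    (fun j _ => by simpa using hinterior j) hinj.injOn
  rw [Finset.card_univ, Fintype.card_fin] at hle
  omega

/-- A compact subset of the `m`-skeleton of a cube has covering dimension at most `m`. -/
theorem covDim_le_of_card_interior_le {W : Type*} [Fintype W]
    (Y : Set (W → Set.Icc (0 : ℝ) 1)) (hY : IsCompact Y) (m : ℕ)
    (hcard : ∀ y ∈ Y,
      (Finset.univ.filter fun w => (y w : ℝ) ∈ Set.Ioo (0 : ℝ) 1).card ≤ m) :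
    covDim Y ≤ (m : ℕ∞) := by
  refine sInf_le fun 𝒰 h𝒰 => ?_
  have : CompactSpace Y := isCompact_iff_compactSpace.1 hY
  obtain ⟨δ, hδ, hleb⟩ := lebesgue_number_lemma_of_metric_sUnion (c := (𝒰 : Set (Set Y)))
    isCompact_univ (fun t ht => h𝒰.1 t ht) (by
      rw [← h𝒰.2, Set.sUnion_eq_biUnion]
      simp)
  obtain ⟨N, hN⟩ := exists_nat_gt (1 / δ)
  rw [div_lt_iff₀ hδ] at hN
  let θ : Fin (m + 1) → ℝ := fun j => ((j : ℕ) + 1 : ℝ) / (m + 2)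
  have hθ : ∀ j, 0 ≤ θ j ∧ θ j ≤ 1 := by
    intro j
    refine ⟨by positivity, div_le_one_of_le₀ ?_ (by positivity)⟩
    have : ((j : ℕ) : ℝ) ≤ m := by exact_mod_cast Nat.lt_succ_iff.1 j.2
    linarith
  let 𝒱 : Finset (Set Y) :=
    ((Finset.univ ×ˢ Fintype.piFinset fun _ : W => Finset.Icc (-1 : ℤ) N).image
      fun p : Fin (m + 1) × (W → ℤ) => gridCell Y N (θ p.1) p.2).filter Set.Nonempty
  have hmem : ∀ V ∈ 𝒱, V.Nonempty ∧ ∃ j c, gridCell Y N (θ j) c = V := by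
    intro V hV
    simp only [𝒱, Finset.mem_filter, Finset.mem_image] at hV
    obtain ⟨⟨p, _, hp⟩, hne⟩ := hV
    exact ⟨hne, p.1, p.2, hp⟩
  refine ⟨𝒱, ⟨fun V hV => ?_, Set.eq_univ_of_forall fun y => ?_⟩, fun V hV => ?_, fun y => ?_⟩
  · obtain ⟨-, j, c, rfl⟩ := hmem V hV
    exact isOpen_gridCell Y N (θ j) c
  · obtain ⟨j, hj⟩ := exists_mem_gridCell y (hcard y.1 y.2) N
    refine Set.mem_biUnion (x := gridCell Y N (θ j) fun w => ⌊N * (y.1 w : ℝ) - θ j⌋) ?_ hj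
    refine Finset.mem_filter.2 ⟨Finset.mem_image.2 ⟨(j, _), ?_, rfl⟩, ⟨y, hj⟩⟩
    refine Finset.mem_product.2 ⟨Finset.mem_univ _, Fintype.mem_piFinset.2 fun w => ?_⟩
    have h0 := (y.1 w).2.1
    have h1 := (y.1 w).2.2
    have hN0 : (0 : ℝ) ≤ N := Nat.cast_nonneg N
    have hlow : (0 : ℝ) ≤ N * (y.1 w : ℝ) := mul_nonneg hN0 h0
    have hup : N * (y.1 w : ℝ) ≤ N := mul_le_of_le_one_right hN0 h1
    refine Finset.mem_Icc.2 ⟨Int.le_floor.2 ?_, Int.floor_le_iff.2 ?_⟩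
    · push_cast
      linarith [(hθ j).2]
    · push_cast
      linarith [(hθ j).1]
  · obtain ⟨⟨x, hx⟩, j, c, rfl⟩ := hmem V hV
    obtain ⟨U, hU, hsub⟩ := hleb x (Set.mem_univ x)
    exact ⟨U, hU, fun y hy => hsub (dist_lt_of_mem_gridCell hδ hN hy hx)⟩
  · have hsub : (𝒱.filter fun V => y ∈ V) ⊆ Finset.univ.image fun j : Fin (m + 1) =>
        gridCell Y N (θ j) fun w => ⌊N * (y.1 w : ℝ) - θ j⌋ := by
      intro V hV
      rw [Finset.mem_filter] at hV
      obtain ⟨-, j, c, rfl⟩ := hmem V hV.1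
      rw [eq_floor_of_mem_gridCell hV.2]
      exact Finset.mem_image_of_mem _ (Finset.mem_univ j)
    have hle := (Finset.card_le_card hsub).trans Finset.card_image_le
    rw [Finset.card_univ, Fintype.card_fin] at hle
    exact_mod_cast hle

/-- If every point of a compact `Z` agrees with `ξ` in at most `m` coordinates, then uniformly
every point of `Z` is close to `ξ` in at most `m` coordinates. -/
theorem eventually_forall_card_close_le {W : Type*} [Fintype W]
    {Z : Set (W → Set.Icc (0 : ℝ) 1)} (hZ : IsCompact Z) {m : ℕ}
    {ξ : W → Set.Icc (0 : ℝ) 1}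
    (hcard : ∀ z ∈ Z, (Finset.univ.filter fun w => z w = ξ w).card ≤ m) :
    ∀ᶠ ε : ℝ in 𝓝 0, ∀ z ∈ Z,
      (Finset.univ.filter fun w => |(z w : ℝ) - ξ w| < ε).card ≤ m := by
  refine hZ.eventually_forall_of_forall_eventually fun z hz => ?_
  have hfar : ∀ w, z w ≠ ξ w →
      ∀ᶠ p : ℝ × (W → Set.Icc (0 : ℝ) 1) in 𝓝 (0, z), p.1 < |(p.2 w : ℝ) - ξ w| := by
    intro w hw
    refine (isOpen_lt (by fun_prop) (by fun_prop)).mem_nhds ?_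
    exact abs_pos.2 (sub_ne_zero.2 fun h => hw (Subtype.ext h))
  have hall : ∀ᶠ p : ℝ × (W → Set.Icc (0 : ℝ) 1) in 𝓝 (0, z),
      ∀ w, z w ≠ ξ w → p.1 < |(p.2 w : ℝ) - ξ w| :=
    eventually_all.2 fun w => eventually_imp_distrib_left.2 (hfar w)
  filter_upwards [hall] with p hp
  refine (Finset.card_le_card fun w hw => ?_).trans (hcard z hz)
  simp only [Finset.mem_filter, Finset.mem_univ, true_and] at hw ⊢
  by_contra hne
  exact (hp w hne).not_gt hw

/-- Let `W` be a finite set, `Z` a closed subset of `[0,1]^W`, `m ∈ ℕ`, and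
`ξ ∈ (0,1)^W` such that for every `S ⊆ W` with `|S| ≥ m` the restriction `ξ|_S` is not the
restriction of any element of `Z`.  Then there is a continuous map `Ψ : Z → [0,1]^W` whose
image has covering dimension at most `m` and which preserves the coordinates equal to `0`
or `1`. -/
theorem exists_maps_down {W : Type*} [Fintype W]
    (Z : Set (W → Set.Icc (0 : ℝ) 1)) (hZ : IsClosed Z) (m : ℕ)
    (ξ : W → Set.Icc (0 : ℝ) 1) (hξ : ∀ w, (ξ w : ℝ) ∈ Set.Ioo (0 : ℝ) 1)
    (hsep : ∀ S : Finset W, m ≤ S.card → ¬∃ z ∈ Z, ∀ w ∈ S, z w = ξ w) :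
    ∃ Ψ : Z → (W → Set.Icc (0 : ℝ) 1), Continuous Ψ ∧
      covDim (Set.range Ψ) ≤ (m : ℕ∞) ∧
      (∀ (z : Z) (w : W), ((z : W → Set.Icc (0 : ℝ) 1) w : ℝ) = 0 → (Ψ z w : ℝ) = 0) ∧
      (∀ (z : Z) (w : W), ((z : W → Set.Icc (0 : ℝ) 1) w : ℝ) = 1 → (Ψ z w : ℝ) = 1) := by
  have hcard : ∀ z ∈ Z, (Finset.univ.filter fun w => z w = ξ w).card ≤ m := by
    intro z hz
    by_contra! hlt
    exact hsep _ hlt.le ⟨z, hz, fun w hw => (Finset.mem_filter.1 hw).2⟩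
  have hsmall : ∀ᶠ ε : ℝ in 𝓝 0, ∀ w, ε < ξ w ∧ ε < 1 - ξ w :=
    eventually_all.2 fun w =>
      (eventually_lt_nhds (hξ w).1).and (eventually_lt_nhds (sub_pos.2 (hξ w).2))
  obtain ⟨ε, ⟨hclose, hε⟩, hε0⟩ :=
    (((eventually_forall_card_close_le hZ.isCompact hcard).and hsmall).filter_mono
      (nhdsWithin_le_nhds (s := Set.Ioi 0)) |>.and self_mem_nhdsWithin).exists
  have : CompactSpace Z := isCompact_iff_compactSpace.1 hZ.isCompact
  let Ψ : Z → (W → Set.Icc (0 : ℝ) 1) := fun z w =>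
    Set.projIcc 0 1 zero_le_one (((z.1 w : ℝ) - ξ w) / ε + 1 / 2)
  have hΨ : Continuous Ψ :=
    continuous_pi fun w => continuous_projIcc.comp <|
      (((continuous_subtype_val.comp ((continuous_apply w).comp continuous_subtype_val)).sub
        continuous_const).div_const ε).add continuous_const
  refine ⟨Ψ, hΨ, covDim_le_of_card_interior_le _ (isCompact_range hΨ) m ?_, ?_, ?_⟩
  · rintro _ ⟨z, rfl⟩
    refine (Finset.card_le_card fun w hw => ?_).trans (hclose z.1 z.2)
    simp only [Finset.mem_filter, Finset.mem_univ, true_and] at hw ⊢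
    have hlow : 0 < ((z.1 w : ℝ) - ξ w) / ε + 1 / 2 := by
      by_contra! h
      have hw0 := hw.1
      simp only [Ψ, Set.projIcc_of_le_left _ h, lt_irrefl] at hw0
    have hup : ((z.1 w : ℝ) - ξ w) / ε + 1 / 2 < 1 := by
      by_contra! h
      have hw1 := hw.2
      simp only [Ψ, Set.projIcc_of_right_le _ h, lt_irrefl] at hw1
    rw [← div_lt_one hε0, ← abs_of_pos hε0, ← abs_div, abs_lt]
    constructor <;> linarith
  · intro z w hz
    have h : ((z.1 w : ℝ) - ξ w) / ε + 1 / 2 ≤ 0 := by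
      have : ((z.1 w : ℝ) - ξ w) / ε ≤ -1 := by
        rw [div_le_iff₀ hε0]
        linarith [(hε w).1]
      linarith
    simp only [Ψ, Set.projIcc_of_le_left _ h]
  · intro z w hz
    have h : 1 ≤ ((z.1 w : ℝ) - ξ w) / ε + 1 / 2 := by
      have : 1 ≤ ((z.1 w : ℝ) - ξ w) / ε := by
        rw [le_div_iff₀ hε0]
        linarith [(hε w).2]
      linarith
    simp only [Ψ, Set.projIcc_of_right_le _ h]

end SoficMD
end
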